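/- Let (E, d) be a Bratteli diagram such that d(v) > Σ_{e ∈ E¹v} d(s(e)) for every v ∈ E⁰, and set δ(v) := d(v) − Σ_{e ∈ E¹v} d(s(e)) − 1. Let G be the graph with vertex set G⁰ = E⁰ ⊔ {x_i^v : v ∈ E⁰, 1 ≤ i ≤ δ(v)} and edge set G¹ = E¹ ⊔ {e_i^v : v ∈ E⁰, 1 ≤ i ≤ δ(v)}, where every edge of E keeps its source and range and each new edge e_i^v goes from x_i^v to v. Then for every v ∈ E⁰, d(v) equals the number of paths in G with range v, where the length-zero path at v is counted among these paths. -/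

import Mathlib

/-- Paths in a directed graph with vertex set `V`, edge set `E`, source map `s` and
range map `r`.  `DPath s r u v` is the type of paths from `u` to `v`; the length-zero
path at `v` is `DPath.nil v`. -/
inductive DPath {V E : Type} (s r : E → V) : V → V → Type
  | nil (v : V) : DPath s r v v
  | cons {w : V} (e : E) (p : DPath s r (r e) w) : DPath s r (s e) w

/-- A Bratteli diagram: a directed graph with no sinks whose vertex set is partitioned
into finite levels `W_n = {v | level v = n}` (for `n ≥ 1`) such that every edge goes
from some level `n` to level `n + 1`, together with a degree function `d` taking
positive values and satisfying `d v ≥ ∑_{e ∈ E¹v} d (s e)` for every vertex `v`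
(the sum being over the, necessarily finitely many, edges with range `v`). -/
structure BratteliDiagram where
  V : Type
  E : Type
  s : E → V
  r : E → V
  level : V → ℕ
  d : V → ℕ
  level_pos : ∀ v, 1 ≤ level v
  level_finite : ∀ n, {v | level v = n}.Finite
  edge_level : ∀ e, level (r e) = level (s e) + 1
  no_sinks : ∀ v, ∃ e, s e = v
  d_pos : ∀ v, 0 < d v
  edges_to_finite : ∀ v, {e | r e = v}.Finite
  d_ge : ∀ v, ∑ᶠ e ∈ {e | r e = v}, d (s e) ≤ d v

/-- `∑_{α ∈ W_k E* v} d (s α)`: the sum of `d` over the sources of all paths with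
range `v` and source in level `k` (the length-zero path at `v` being included when
`level v = k`). -/
noncomputable def levelPathSum (B : BratteliDiagram) (k : ℕ) (v : B.V) : ℕ :=
  ∑ᶠ p ∈ {p : (u : B.V) × DPath B.s B.r u v | B.level p.1 = k}, B.d p.1

/-- The sum `∑_{e ∈ E¹v} d (s e)` over the edges with range `v`. -/
noncomputable def inDeg (B : BratteliDiagram) (v : B.V) : ℕ :=
  ∑ᶠ e ∈ {e | B.r e = v}, B.d (B.s e)

/-- `δ v = d v − ∑_{e ∈ E¹v} d (s e) − 1`. -/
noncomputable def deltaNum (B : BratteliDiagram) (v : B.V) : ℕ :=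
  B.d v - inDeg B v - 1

/-- Vertex set of the graph `G` of Theorem 5.7:
`G⁰ = E⁰ ⊔ {x_i^v : v ∈ E⁰, 1 ≤ i ≤ δ v}`. -/
noncomputable def GV9 (B : BratteliDiagram) : Type :=
  B.V ⊕ (Σ v : B.V, {i : ℕ // 1 ≤ i ∧ i ≤ deltaNum B v})

/-- Edge set of the graph `G` of Theorem 5.7:
`G¹ = E¹ ⊔ {e_i^v : v ∈ E⁰, 1 ≤ i ≤ δ v}`, where `e_i^v` goes from `x_i^v` to `v`. -/
noncomputable def GE9 (B : BratteliDiagram) : Type :=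
  B.E ⊕ (Σ v : B.V, {i : ℕ // 1 ≤ i ∧ i ≤ deltaNum B v})

/-- Source map of `G`: edges of `E` keep their source; `e_i^v` has source `x_i^v`. -/
noncomputable def gs9 (B : BratteliDiagram) : GE9 B → GV9 B
  | Sum.inl e => Sum.inl (B.s e)
  | Sum.inr p => Sum.inr p

/-- Range map of `G`: edges of `E` keep their range; `e_i^v` has range `v`. -/
noncomputable def gr9 (B : BratteliDiagram) : GE9 B → GV9 B
  | Sum.inl e => Sum.inl (B.r e)
  | Sum.inr p => Sum.inl p.1

namespace DPath

variable {V E : Type} {s r : E → V}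

/-- Extend a path by one edge at its end. -/
def snoc (e : E) {u w : V} : DPath s r u w → w = s e → DPath s r u (r e)
  | nil _, h => h ▸ cons e (nil (r e))
  | cons f p, h => cons f (snoc e p h)

/-- The list of edges traversed by a path. -/
def edges {u w : V} : DPath s r u w → List E
  | nil _ => []
  | cons e p => e :: edges p

theorem edges_snoc (e : E) {u w : V} (p : DPath s r u w) (h : w = s e) :
    (p.snoc e h).edges = p.edges ++ [e] := by
  induction p with
  | nil v => subst h; rfl
  | cons f p ih => simp [snoc, edges, ih]

theorem edges_injective (w : V) :
    Function.Injective fun p : (u : V) × DPath s r u w => p.2.edges := by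
  rintro ⟨u, p⟩ ⟨u', q⟩ h
  dsimp only at h
  induction p generalizing u' with
  | nil v => cases q with
    | nil => rfl
    | cons e q => simp [edges] at h
  | cons e p ih => cases q with
    | nil => simp [edges] at h
    | cons e' q =>
      simp only [edges, List.cons.injEq] at h
      obtain ⟨rfl, h⟩ := h
      have := ih _ q h
      simp only [Sigma.mk.injEq, heq_eq_eq, true_and] at this
      rw [this]

theorem eq_nil_or_snoc {u w : V} (p : DPath s r u w) :
    (⟨u, p⟩ : (u : V) × DPath s r u w) = ⟨w, nil w⟩ ∨
      ∃ (e : E) (q : DPath s r u (s e)), r e = w ∧ p.edges = q.edges ++ [e] := by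
  induction p with
  | nil v => exact Or.inl rfl
  | @cons w e p ih =>
    right
    rcases ih with h | ⟨f, q, hf, h⟩
    · obtain ⟨rfl, h⟩ := Sigma.mk.inj_iff.mp h
      rw [eq_of_heq h]
      exact ⟨e, nil _, rfl, rfl⟩
    · exact ⟨f, cons e q, hf, by simp [edges, h]⟩

/-- Build a path with range `w` either as the trivial path at `w` or by appending an edge
with range `w`. -/
def ofLast (w : V) :
    Option ((e : {e : E // r e = w}) × (u : V) × DPath s r u (s e)) → (u : V) × DPath s r u w
  | none => ⟨w, nil w⟩
  | some ⟨⟨e, he⟩, u, p⟩ => ⟨u, he ▸ p.snoc e rfl⟩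

theorem ofLast_bijective (w : V) : Function.Bijective (ofLast (s := s) (r := r) w) := by
  have edges_some (e : E) (he : r e = w) (u : V) (p : DPath s r u (s e)) :
      (ofLast w (some ⟨⟨e, he⟩, u, p⟩)).2.edges = p.edges ++ [e] := by
    subst he
    exact edges_snoc e p rfl
  constructor
  · rintro (_ | ⟨⟨e, he⟩, u, p⟩) (_ | ⟨⟨f, hf⟩, u', q⟩) h
    · rfl
    · have := congrArg (fun p => p.2.edges) h
      simp only [edges_some] at this
      exact absurd this (List.append_ne_nil_of_right_ne_nil _ (List.cons_ne_nil _ _)).symm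
    · have := congrArg (fun p => p.2.edges) h
      simp only [edges_some] at this
      exact absurd this (List.append_ne_nil_of_right_ne_nil _ (List.cons_ne_nil _ _))
    · have := congrArg (fun p => p.2.edges) h
      simp only [edges_some] at this
      obtain ⟨hpq, hef⟩ := List.append_inj' this rfl
      obtain rfl : e = f := by simpa using hef
      rw [edges_injective (s e) (a₁ := ⟨u, p⟩) (a₂ := ⟨u', q⟩) hpq]
  · rintro ⟨u, p⟩
    rcases eq_nil_or_snoc p with h | ⟨e, q, he, h⟩
    · exact ⟨none, h.symm⟩
    · exact ⟨some ⟨⟨e, he⟩, u, q⟩, edges_injective w ((edges_some e he u q).trans h.symm)⟩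

/-- The number of paths with range `w` satisfies the recursion over the edges into `w`. -/
theorem card_range_eq (w : V) [Fintype {e : E // r e = w}]
    [∀ e : {e : E // r e = w}, Finite ((u : V) × DPath s r u (s e))] :
    Nat.card ((u : V) × DPath s r u w) =
      (∑ e : {e : E // r e = w}, Nat.card ((u : V) × DPath s r u (s e))) + 1 := by
  rw [← Nat.card_congr (Equiv.ofBijective _ (ofLast_bijective w)), Finite.card_option,
    Nat.card_sigma]

end DPath

/-- The edges of `G` into an old vertex `v` are the old edges into `v` and the `δ v` new ones. -/
noncomputable def edgesIntoEquiv (B : BratteliDiagram) (v : B.V) :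
    {e : GE9 B // gr9 B e = Sum.inl v} ≃
      {e : B.E // B.r e = v} ⊕ {i : ℕ // 1 ≤ i ∧ i ≤ deltaNum B v} :=
  Equiv.subtypeSum.trans <| Equiv.sumCongr
    (Equiv.subtypeEquivRight fun _ => Sum.inl_injective.eq_iff)
    ((Equiv.subtypeEquivRight fun _ => Sum.inl_injective.eq_iff).trans (Equiv.sigmaSubtype v))

theorem card_paths_new_vertex (B : BratteliDiagram)
    (x : Σ v : B.V, {i : ℕ // 1 ≤ i ∧ i ≤ deltaNum B v}) :
    Nat.card ((u : GV9 B) × DPath (gs9 B) (gr9 B) u (Sum.inr x)) = 1 := by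
  have : IsEmpty {e : GE9 B // gr9 B e = Sum.inr x} :=
    ⟨by rintro ⟨_ | _, h⟩ <;> exact Sum.inl_ne_inr h⟩
  let _ : Fintype {e : GE9 B // gr9 B e = Sum.inr x} := Fintype.ofIsEmpty
  have : ∀ e : {e : GE9 B // gr9 B e = Sum.inr x},
      Finite ((u : GV9 B) × DPath (gs9 B) (gr9 B) u (gs9 B e)) := fun e => isEmptyElim e
  refine (DPath.card_range_eq _).trans ?_
  rw [Fintype.sum_empty]

/-!
STATEMENT 9 (combinatorial content of Theorem 5.7 of the paper).  Let `(E, d)` be a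
Bratteli diagram with `d v > ∑_{e ∈ E¹v} d (s e)` for every vertex `v`, and let `G` be
the graph obtained from `E` by attaching, for each vertex `v`, new vertices
`x_1^v, …, x_{δ v}^v` each emitting a single edge into `v`.  Then for every `v ∈ E⁰`,
`d v` equals the number of paths in `G` with range `v`, the length-zero path at `v`
being counted among them.
-/
theorem stmt_9 (B : BratteliDiagram)
    (hproper : ∀ v : B.V, inDeg B v < B.d v)
    (v : B.V) :
    B.d v = Nat.card
      ((u : GV9 B) × DPath (gs9 B) (gr9 B) u (Sum.inl v)) := by
  induction hn : B.level v using Nat.strong_induction_on generalizing v with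
  | _ n ih =>
    subst hn
    have card_source (e : {e : GE9 B // gr9 B e = Sum.inl v}) :
        Nat.card ((u : GV9 B) × DPath (gs9 B) (gr9 B) u (gs9 B e)) =
          Sum.elim (fun e : {e : B.E // B.r e = v} => B.d (B.s e)) (fun _ => 1)
            (edgesIntoEquiv B v e) := by
      obtain ⟨e | x, he⟩ := e
      · have hr : B.r e = v := Sum.inl_injective he
        exact (ih _ (by rw [← hr, B.edge_level]; omega) (B.s e) rfl).symm
      · exact card_paths_new_vertex B x
    have (e : {e : GE9 B // gr9 B e = Sum.inl v}) :
        Finite ((u : GV9 B) × DPath (gs9 B) (gr9 B) u (gs9 B e)) := by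
      refine Nat.finite_of_card_ne_zero ?_
      rw [card_source]
      rcases edgesIntoEquiv B v e with e | i
      · exact (B.d_pos _).ne'
      · exact one_ne_zero
    let _ : Fintype {e : B.E // B.r e = v} := (B.edges_to_finite v).fintype
    let _ : Fintype {i : ℕ // 1 ≤ i ∧ i ≤ deltaNum B v} :=
      Fintype.subtype (Finset.Icc 1 (deltaNum B v)) (by simp)
    let _ : Fintype {e : GE9 B // gr9 B e = Sum.inl v} :=
      Fintype.ofEquiv _ (edgesIntoEquiv B v).symm
    have card_new : Fintype.card {i : ℕ // 1 ≤ i ∧ i ≤ deltaNum B v} = deltaNum B v := by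
      rw [Fintype.card_of_subtype (Finset.Icc 1 (deltaNum B v)) (by simp)]
      simp
    have sum_old : ∑ e : {e : B.E // B.r e = v}, B.d (B.s e) = inDeg B v := by
      rw [inDeg, ← finsum_eq_sum_of_fintype]
      exact finsum_set_coe_eq_finsum_mem (f := fun e => B.d (B.s e)) {e | B.r e = v}
    refine Eq.trans ?_ (DPath.card_range_eq _).symm
    rw [Fintype.sum_congr _ _ card_source,
      Equiv.sum_comp (edgesIntoEquiv B v), Fintype.sum_sum_type]
    simp only [Sum.elim_inl, Sum.elim_inr, sum_old, Finset.sum_const, Finset.card_univ, card_new,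
      smul_eq_mul, mul_one]
    have := hproper v
    unfold deltaNum
    omega
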